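/- arXiv:1511.06209 — 4 statements merged into one kernel-verified Lean document; each statement's English description precedes it below -/
import Mathlib

section
/- Let N ≥ 1 and let j ≥ 0 be an integer. The series Σ_{d≥0} Σ_{a∈A_{+,d}} a^{q^j·N}/a converges in K_∞ (the valuations of the degree-d partial sums tend to infinity), and its sum equals 0 if and only if N ≡ 1 (mod q−1) and q^j·N > 1. -/
open Polynomial

noncomputable section

variable (Fq : Type*) [Field Fq] [Fintype Fq]

/-- The monic polynomial of degree `d` in `θ` with lower-order coefficients `c`;
as `c` runs through `Fin d → Fq` this runs through `A_{+,d}`. -/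
def monicOfDeg (d : ℕ) (c : Fin d → Fq) : Polynomial Fq :=
  X ^ d + ∑ i : Fin d, C (c i) * X ^ (i : ℕ)

/-- The `k`-th power sum over an affine `Fq`-space spanned by `d > k` directions vanishes. -/
lemma sum_affine_pow_eq_zero {R : Type*} [CommRing R] [Algebra Fq R] (d : ℕ) :
    ∀ (k : ℕ), k < d → ∀ (w : R) (v : Fin d → R),
      ∑ c : Fin d → Fq, (w + ∑ i, algebraMap Fq R (c i) * v i) ^ k = 0 := by
  induction d with
  | zero => intro k hk; omega
  | succ d ih =>
    intro k hk w v
    rw [← (Fin.consEquiv fun _ : Fin (d + 1) => Fq).sum_comp, Fintype.sum_prod_type]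
    have expand : ∀ (x : Fq) (c : Fin d → Fq),
        (w + ∑ i, algebraMap Fq R ((Fin.consEquiv fun _ : Fin (d + 1) => Fq) (x, c) i) * v i) ^ k
          = ∑ l ∈ Finset.range (k + 1),
            (w + ∑ i, algebraMap Fq R (c i) * v i.succ) ^ l *
              ((algebraMap Fq R x * v 0) ^ (k - l) * (k.choose l : R)) := by
      intro x c
      simp only [Fin.consEquiv_apply, Fin.sum_univ_succ, Fin.cons_zero, Fin.cons_succ]
      rw [add_left_comm, add_comm, add_pow]
      simp only [mul_assoc]
    simp only [expand]
    rw [Finset.sum_congr rfl fun x _ => Finset.sum_comm, Finset.sum_comm]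
    refine Finset.sum_eq_zero fun l hl => ?_
    simp only [← Finset.sum_mul]
    rcases (Nat.lt_succ_iff.mp (Finset.mem_range.mp hl)).lt_or_eq with h | rfl
    · simp [ih l (by omega) w fun i => v i.succ]
    · have hq : (Fintype.card Fq : R) = 0 := by
        rw [← map_natCast (algebraMap Fq R), FiniteField.cast_card_eq_zero, map_zero]
      simp [hq]

lemma sum_monicOfDeg_pow_eq_zero {d m : ℕ} (h : m < d) :
    ∑ c : Fin d → Fq, monicOfDeg Fq d c ^ m = 0 :=
  sum_affine_pow_eq_zero Fq d m h (X ^ d) fun i => (X : Fq[X]) ^ (i : ℕ)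

/-- When `q - 1 ∣ m`, the `m`-th power sum over all polynomials of degree `< D` is minus
the sum over the monic ones. -/
lemma sum_lt_degree_pow_eq_neg {m : ℕ} (hm : m ≠ 0) (hdvd : Fintype.card Fq - 1 ∣ m) (D : ℕ) :
    ∑ c : Fin D → Fq, (∑ i, C (c i) * (X : Fq[X]) ^ (i : ℕ)) ^ m =
      -∑ d ∈ Finset.range D, ∑ c : Fin d → Fq, monicOfDeg Fq d c ^ m := by
  classical
  induction D with
  | zero => simp [hm]
  | succ D ih =>
    rw [Finset.sum_range_succ, neg_add, ← ih,
      ← (Fin.snocEquiv fun _ : Fin (D + 1) => Fq).sum_comp, Fintype.sum_prod_type]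
    have split : ∀ (x : Fq) (c : Fin D → Fq),
        ∑ i, C ((Fin.snocEquiv fun _ : Fin (D + 1) => Fq) (x, c) i) * (X : Fq[X]) ^ (i : ℕ) =
          C x * X ^ D + ∑ i, C (c i) * (X : Fq[X]) ^ (i : ℕ) := by
      intro x c
      simp [Fin.sum_univ_castSucc, add_comm]
    simp only [split]
    have scale : ∀ x : Fq, x ≠ 0 →
        ∑ c : Fin D → Fq, (C x * X ^ D + ∑ i, C (c i) * (X : Fq[X]) ^ (i : ℕ)) ^ m =
          ∑ c : Fin D → Fq, monicOfDeg Fq D c ^ m := by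
      intro x hx
      have hxm : x ^ m = 1 := by
        obtain ⟨r, rfl⟩ := hdvd
        rw [pow_mul, FiniteField.pow_card_sub_one_eq_one x hx, one_pow]
      rw [← (Equiv.piCongrRight fun _ : Fin D => Equiv.mulLeft₀ x hx).sum_comp]
      refine Finset.sum_congr rfl fun c _ => ?_
      have hfac : C x * X ^ D +
          ∑ i, C ((Equiv.piCongrRight fun _ : Fin D => Equiv.mulLeft₀ x hx) c i) *
            (X : Fq[X]) ^ (i : ℕ) = C x * monicOfDeg Fq D c := by
        simp [monicOfDeg, mul_add, Finset.mul_sum, mul_assoc]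
      rw [hfac, mul_pow, ← C_pow, hxm, C_1, one_mul]
    rw [← Finset.add_sum_erase _ _ (Finset.mem_univ (0 : Fq)),
      Finset.sum_congr rfl fun x hx => scale x (Finset.ne_of_mem_erase hx)]
    have hq : ((Fintype.card Fq - 1 : ℕ) : Fq[X]) = -1 := by
      rw [Nat.cast_sub Fintype.card_pos, ← map_natCast (C : Fq →+* Fq[X]),
        FiniteField.cast_card_eq_zero]
      simp
    simp [Finset.card_erase_of_mem, hq]

/-- When `q - 1 ∤ m`, the constant term of a power sum over `A_{+,d}` with `d ≥ 1` is zero. -/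
lemma eval_zero_sum_monicOfDeg_pow {m : ℕ} (hdvd : ¬ Fintype.card Fq - 1 ∣ m) (d : ℕ) :
    (∑ c : Fin (d + 1) → Fq, monicOfDeg Fq (d + 1) c ^ m).eval 0 = 0 := by
  classical
  rw [eval_finsetSum, ← (Fin.consEquiv fun _ : Fin (d + 1) => Fq).sum_comp,
    Fintype.sum_prod_type, Finset.sum_comm]
  refine Finset.sum_eq_zero fun c _ => ?_
  have hm : m ≠ 0 := by rintro rfl; exact hdvd (dvd_zero _)
  have h := FiniteField.sum_pow_units Fq m
  rw [if_neg hdvd] at h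
  have key : ∑ x : Fq, x ^ m = 0 := by
    rw [← Finset.add_sum_erase _ _ (Finset.mem_univ (0 : Fq)), zero_pow hm, zero_add]
    refine Eq.trans (Eq.symm ?_) h
    refine Finset.sum_bij (fun u _ => (u : Fq)) (by simp) (fun _ _ _ _ => Units.ext) ?_ (by simp)
    intro b hb
    exact ⟨Units.mk0 b (Finset.ne_of_mem_erase hb), by simp⟩
  simpa [monicOfDeg, Fin.sum_univ_succ, eval_finsetSum] using key

lemma modEq_one_iff_dvd {q N j : ℕ} (hq : 1 ≤ q) (hN : 1 ≤ N) :
    N ≡ 1 [MOD q - 1] ↔ q - 1 ∣ q ^ j * N - 1 := by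
  have hqj : q ^ j * N ≡ N [MOD q - 1] := by
    have h1 : q ≡ 1 [MOD q - 1] := ((Nat.modEq_iff_dvd' hq).mpr dvd_rfl).symm
    simpa using (h1.pow j).mul_right N
  rw [← Nat.modEq_iff_dvd' (Nat.mul_pos (pow_pos hq j) hN)]
  exact ⟨fun h => (hqj.trans h).symm, fun h => hqj.symm.trans h.symm⟩

/-- Let `N ≥ 1` and `j ≥ 0`.  The series `Σ_{d≥0} Σ_{a ∈ A_{+,d}} a^{q^j·N}/a` (whose
terms `a^{q^j·N}/a = a^{q^j·N - 1}` are polynomials, i.e. elements of `A ⊆ K_∞` of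
valuation `≤ 0` unless zero) converges in `K_∞`: this means precisely that the degree-`d`
partial sums vanish for all large `d`, and the sum equals `0` if and only if
`N ≡ 1 (mod q-1)` and `q^j·N > 1`. -/
theorem powerSum_convergence_and_vanishing (N j : ℕ) (hN : 1 ≤ N) :
    ∃ D : ℕ,
      (∀ d : ℕ, D ≤ d →
        (∑ c : Fin d → Fq, monicOfDeg Fq d c ^ (Fintype.card Fq ^ j * N - 1)) = 0) ∧
      ((∑ d ∈ Finset.range D, ∑ c : Fin d → Fq,
          monicOfDeg Fq d c ^ (Fintype.card Fq ^ j * N - 1)) = 0 ↔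
        (N ≡ 1 [MOD Fintype.card Fq - 1] ∧ 1 < Fintype.card Fq ^ j * N)) := by
  rw [modEq_one_iff_dvd (j := j) Fintype.card_pos hN, ← Nat.sub_pos_iff_lt]
  generalize Fintype.card Fq ^ j * N - 1 = m
  refine ⟨m + 1, fun d hd => sum_monicOfDeg_pow_eq_zero Fq hd, fun h => ?_, fun ⟨hdvd, hm⟩ => ?_⟩
  · by_cases hdvd : Fintype.card Fq - 1 ∣ m
    · refine ⟨hdvd, Nat.pos_of_ne_zero ?_⟩
      rintro rfl
      simp at h
    · have h0 := congrArg (eval 0) h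
      rw [Finset.sum_range_succ', eval_add, eval_finsetSum,
        Finset.sum_eq_zero fun d _ => eval_zero_sum_monicOfDeg_pow Fq hdvd d] at h0
      simp [monicOfDeg] at h0
  · rw [← neg_eq_zero, ← sum_lt_degree_pow_eq_neg Fq hm.ne' hdvd]
    simpa using sum_affine_pow_eq_zero Fq (m + 1) m m.lt_succ_self 0
      fun i => (X : Fq[X]) ^ (i : ℕ)

end
end

section
/- For every integer d ≥ 0, Σ_{a∈A_{+,d}} 1/a = 1/ℓ_d in K, where ℓ_0 = 1 and ℓ_d = (θ − θ^q)(θ − θ^{q^2})⋯(θ − θ^{q^d}) for d ≥ 1. -/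
open Polynomial

noncomputable section

variable (Fq : Type*) [Field Fq] [Fintype Fq]

/-- `ℓ_0 = 1`, `ℓ_d = (θ-θ^q)(θ-θ^{q^2})⋯(θ-θ^{q^d})`. -/
def elld (d : ℕ) : Polynomial Fq :=
  ∏ i ∈ Finset.Icc 1 d, (X - X ^ Fintype.card Fq ^ i)

section CarlitzPolynomials

variable {L : Type*} [Field L] [Algebra Fq L]

/-- Carlitz's product `D_d`, defined by `D_0 = 1`, `D_{d+1} = (θ^{q^{d+1}} - θ) D_d^q`. -/
def carlitzD (θ : L) : ℕ → L
  | 0 => 1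
  | d + 1 => (θ ^ Fintype.card Fq ^ (d + 1) - θ) * carlitzD θ d ^ Fintype.card Fq

/-- Carlitz's `Fq`-linear function `e_d`; for `θ` transcendental its kernel is the `Fq`-span of
`1, θ, …, θ^{d-1}`. -/
def carlitzE (θ : L) : ℕ → L →ₗ[Fq] L
  | 0 => LinearMap.id
  | d + 1 => (FiniteField.frobeniusAlgHom Fq L).toLinearMap ∘ₗ carlitzE θ d -
      (carlitzD Fq θ d ^ (Fintype.card Fq - 1)) • carlitzE θ d

lemma carlitzE_succ (θ : L) (d : ℕ) (z : L) :
    carlitzE Fq θ (d + 1) z = carlitzE Fq θ d z ^ Fintype.card Fq -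
      carlitzD Fq θ d ^ (Fintype.card Fq - 1) * carlitzE Fq θ d z := rfl

lemma sub_pow_card (x y : L) :
    (x - y) ^ Fintype.card Fq = x ^ Fintype.card Fq - y ^ Fintype.card Fq :=
  map_sub (FiniteField.frobeniusAlgHom Fq L) x y

lemma add_pow_card (x y : L) :
    (x + y) ^ Fintype.card Fq = x ^ Fintype.card Fq + y ^ Fintype.card Fq :=
  map_add (FiniteField.frobeniusAlgHom Fq L) x y

lemma carlitzE_theta_mul (θ : L) (d : ℕ) (z : L) :
    carlitzE Fq θ (d + 1) (θ * z) = θ * carlitzE Fq θ (d + 1) z +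
      (θ ^ Fintype.card Fq ^ (d + 1) - θ) * carlitzE Fq θ d z ^ Fintype.card Fq := by
  induction d with
  | zero => simp [carlitzE, carlitzD]; ring
  | succ d ih =>
    have hθ : (θ ^ Fintype.card Fq ^ (d + 1) - θ) ^ Fintype.card Fq =
        θ ^ Fintype.card Fq ^ (d + 2) - θ ^ Fintype.card Fq := by
      rw [sub_pow_card, ← pow_mul, ← pow_succ]
    have hD : carlitzD Fq θ (d + 1) ^ (Fintype.card Fq - 1) * (θ ^ Fintype.card Fq ^ (d + 1) - θ) =
        (θ ^ Fintype.card Fq ^ (d + 1) - θ) ^ Fintype.card Fq *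
          (carlitzD Fq θ d ^ (Fintype.card Fq - 1)) ^ Fintype.card Fq := by
      rw [carlitzD, mul_pow, ← pow_mul, ← pow_mul, mul_comm (Fintype.card Fq - 1),
        mul_right_comm, ← pow_succ, Nat.sub_add_cancel Fintype.card_pos]
    have hE : carlitzE Fq θ (d + 1) z ^ Fintype.card Fq =
        (carlitzE Fq θ d z ^ Fintype.card Fq) ^ Fintype.card Fq -
          (carlitzD Fq θ d ^ (Fintype.card Fq - 1)) ^ Fintype.card Fq *
            carlitzE Fq θ d z ^ Fintype.card Fq := by
      rw [carlitzE_succ, sub_pow_card, mul_pow]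
    rw [carlitzE_succ, ih, add_pow_card, mul_pow, mul_pow, carlitzE_succ _ _ (d + 1)]
    rw [hθ] at hD ⊢
    linear_combination (θ ^ Fintype.card Fq - θ ^ Fintype.card Fq ^ (d + 2)) * hE -
      carlitzE Fq θ d z ^ Fintype.card Fq * hD

lemma carlitzE_theta_pow (θ : L) (d : ℕ) : carlitzE Fq θ d (θ ^ d) = carlitzD Fq θ d := by
  induction d with
  | zero => simp [carlitzE, carlitzD]
  | succ d ih =>
    have h : carlitzE Fq θ (d + 1) (θ ^ d) = 0 := by
      rw [carlitzE_succ, ih, ← pow_succ, Nat.sub_add_cancel Fintype.card_pos, sub_self]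
    rw [pow_succ', carlitzE_theta_mul, h, ih, carlitzD, mul_zero, zero_add]

lemma carlitzD_ne_zero (F : Type*) [Fintype F] {L : Type*} [Field L] {θ : L}
    (hθ : ∀ d, θ ^ Fintype.card F ^ (d + 1) ≠ θ) (d : ℕ) :
    carlitzD F θ d ≠ 0 := by
  induction d with
  | zero => exact one_ne_zero
  | succ d ih => exact mul_ne_zero (sub_ne_zero.2 (hθ d)) (pow_ne_zero _ ih)

/-- The partial fraction expansion of `1 / (X^q - X)`. -/
lemma sum_inv_add_algebraMap (x : L) (hx : ∀ c : Fq, x + algebraMap Fq L c ≠ 0) :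
    x ^ Fintype.card Fq - x ≠ 0 ∧
      ∑ c : Fq, (x + algebraMap Fq L c)⁻¹ = -(x ^ Fintype.card Fq - x)⁻¹ := by
  set f : Fq[X] := X ^ Fintype.card Fq - X with hf
  have hroots : f.roots = Finset.univ.val := FiniteField.roots_X_pow_card_sub_X Fq
  have hdeg : f.natDegree = Fintype.card Fq :=
    FiniteField.X_pow_card_sub_X_natDegree_eq Fq Fintype.one_lt_card
  have hsplit : f.Splits := splits_iff_card_roots.2 (by rw [hroots, hdeg]; rfl)
  have hmap : (f.map (algebraMap Fq L)).roots = Finset.univ.val.map (algebraMap Fq L) := by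
    rw [hsplit.roots_map, hroots]
  have heval : (f.map (algebraMap Fq L)).eval x = x ^ Fintype.card Fq - x := by simp [hf]
  have hfne : f.map (algebraMap Fq L) ≠ 0 :=
    (Polynomial.map_ne_zero_iff (algebraMap Fq L).injective).2
      (FiniteField.X_pow_card_sub_X_ne_zero Fq Fintype.one_lt_card)
  have hne : (f.map (algebraMap Fq L)).eval x ≠ 0 := by
    intro h
    have hmem : x ∈ (f.map (algebraMap Fq L)).roots := (mem_roots hfne).2 h
    rw [hmap] at hmem
    obtain ⟨c, -, rfl⟩ := Multiset.mem_map.1 hmem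
    exact hx (-c) (by simp)
  have hder : (f.map (algebraMap Fq L)).derivative.eval x = -1 := by
    have : ((Fintype.card Fq : ℕ) : L) = 0 := by
      rw [← map_natCast (algebraMap Fq L), FiniteField.cast_card_eq_zero, map_zero]
    simp [hf, derivative_X_pow, this]
  have key := (hsplit.map (algebraMap Fq L)).eval_derivative_div_eval_of_ne_zero hne
  rw [hmap, hder, heval, Multiset.map_map] at key
  refine ⟨heval ▸ hne, ?_⟩
  rw [← Equiv.sum_comp (Equiv.neg Fq)]
  rw [neg_div, one_div] at key
  rw [key]
  change _ = ∑ c : Fq, 1 / (x - algebraMap Fq L c)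
  simp [sub_eq_add_neg]

/-- The homogeneous form of `sum_inv_add_algebraMap`. -/
lemma sum_inv_add_smul {w : L} (hw : w ≠ 0) (y : L) (hy : ∀ c : Fq, y + c • w ≠ 0) :
    y ^ Fintype.card Fq - w ^ (Fintype.card Fq - 1) * y ≠ 0 ∧
      ∑ c : Fq, (y + c • w)⁻¹ = -w ^ (Fintype.card Fq - 1) *
        (y ^ Fintype.card Fq - w ^ (Fintype.card Fq - 1) * y)⁻¹ := by
  have hscale (c : Fq) : y + c • w = w * (y / w + algebraMap Fq L c) := by
    rw [Algebra.smul_def]; field_simp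
  have hwq : w ^ Fintype.card Fq = w ^ (Fintype.card Fq - 1) * w := by
    rw [← pow_succ, Nat.sub_add_cancel Fintype.card_pos]
  have hprod : y ^ Fintype.card Fq - w ^ (Fintype.card Fq - 1) * y =
      w ^ (Fintype.card Fq - 1) * w * ((y / w) ^ Fintype.card Fq - y / w) := by
    rw [div_pow, ← hwq, mul_sub, mul_div_cancel₀ _ (pow_ne_zero _ hw), hwq]
    field_simp
  obtain ⟨hne, hsum⟩ := sum_inv_add_algebraMap Fq (y / w) fun c h => hy c (by
    rw [hscale, h, mul_zero])
  have hw' := pow_ne_zero (Fintype.card Fq - 1) hw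
  refine ⟨hprod ▸ mul_ne_zero (mul_ne_zero hw' hw) hne, ?_⟩
  simp_rw [hscale, mul_inv]
  rw [← Finset.mul_sum, hsum, hprod]
  field_simp

/-- The partial fraction expansion of `1 / e_d`. -/
lemma sum_inv_add_span {θ : L} (hθ : ∀ d, θ ^ Fintype.card Fq ^ (d + 1) ≠ θ) (d : ℕ) (z : L)
    (hz : ∀ c : Fin d → Fq, z + ∑ i, c i • θ ^ (i : ℕ) ≠ 0) :
    carlitzE Fq θ d z ≠ 0 ∧
      ∑ c : Fin d → Fq, (z + ∑ i, c i • θ ^ (i : ℕ))⁻¹ =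
        (∏ i ∈ Finset.range d, -carlitzD Fq θ i ^ (Fintype.card Fq - 1)) *
          (carlitzE Fq θ d z)⁻¹ := by
  induction d generalizing z with
  | zero => simpa [carlitzE] using hz
  | succ d ih =>
    have hsnoc (a : Fq) (c : Fin d → Fq) :
        z + ∑ i, (Fin.snoc c a : Fin (d + 1) → Fq) i • θ ^ (i : ℕ) =
          z + a • θ ^ d + ∑ i, c i • θ ^ (i : ℕ) := by
      rw [Fin.sum_univ_castSucc]
      simp only [Fin.snoc_castSucc, Fin.snoc_last, Fin.val_castSucc, Fin.val_last]
      ring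
    have hih (a : Fq) := ih (z + a • θ ^ d) fun c => hsnoc a c ▸ hz _
    simp only [map_add, map_smul, carlitzE_theta_pow] at hih
    obtain ⟨hne, hsum⟩ := sum_inv_add_smul Fq (carlitzD_ne_zero Fq hθ d) (carlitzE Fq θ d z)
      fun a => (hih a).1
    refine ⟨hne, ?_⟩
    rw [← Equiv.sum_comp (Fin.snocEquiv fun _ => Fq), Fintype.sum_prod_type]
    simp only [Fin.snocEquiv_apply, hsnoc, (hih _).2]
    rw [← Finset.mul_sum, hsum, Finset.prod_range_succ, carlitzE_succ]
    ring

lemma prod_mul_inv_carlitzD (F : Type*) [Field F] [Fintype F] {L : Type*} [Field L] {θ : L}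
    (hθ : ∀ d, θ ^ Fintype.card F ^ (d + 1) ≠ θ) (d : ℕ) :
    (∏ i ∈ Finset.range d, -carlitzD F θ i ^ (Fintype.card F - 1)) * (carlitzD F θ d)⁻¹ =
      (∏ i ∈ Finset.Icc 1 d, (θ - θ ^ Fintype.card F ^ i))⁻¹ := by
  induction d with
  | zero => simp [carlitzD]
  | succ d ih =>
    have hD := carlitzD_ne_zero F hθ d
    have hDq : carlitzD F θ d ^ Fintype.card F =
        carlitzD F θ d ^ (Fintype.card F - 1) * carlitzD F θ d := by
      rw [← pow_succ, Nat.sub_add_cancel Fintype.card_pos]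
    have hD' := pow_ne_zero (Fintype.card F - 1) hD
    rw [Finset.prod_Icc_succ_top (by lia), mul_inv, ← ih, Finset.prod_range_succ, carlitzD, hDq,
      ← neg_sub (θ ^ _) θ, inv_neg, mul_inv, mul_inv]
    field_simp

end CarlitzPolynomials

lemma RatFunc.X_pow_card_pow_ne_X (d : ℕ) :
    (RatFunc.X : RatFunc Fq) ^ Fintype.card Fq ^ (d + 1) ≠ RatFunc.X := by
  rw [← RatFunc.algebraMap_X, ← map_pow]
  intro h
  exact FiniteField.X_pow_card_pow_sub_X_ne_zero Fq d.succ_ne_zero Fintype.one_lt_card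
    (sub_eq_zero.2 (RatFunc.algebraMap_injective Fq h))

lemma monicOfDeg_ne_zero (F : Type*) [Field F] (d : ℕ) (c : Fin d → F) : monicOfDeg F d c ≠ 0 :=
  (monic_X_pow_add (degree_sum_fin_lt c)).ne_zero

lemma algebraMap_monicOfDeg (F : Type*) [Field F] (d : ℕ) (c : Fin d → F) :
    algebraMap F[X] (RatFunc F) (monicOfDeg F d c) =
      RatFunc.X ^ d + ∑ i, c i • (RatFunc.X : RatFunc F) ^ (i : ℕ) := by
  simp [monicOfDeg, Algebra.smul_def, RatFunc.algebraMap_eq_C]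

/-- For every `d ≥ 0`: `Σ_{a ∈ A_{+,d}} 1/a = 1/ℓ_d` in `K = Fq(θ)`. -/
theorem sum_inv_monic (d : ℕ) :
    (∑ c : Fin d → Fq, (algebraMap (Polynomial Fq) (RatFunc Fq) (monicOfDeg Fq d c))⁻¹) =
      (algebraMap (Polynomial Fq) (RatFunc Fq) (elld Fq d))⁻¹ := by
  have hθ := RatFunc.X_pow_card_pow_ne_X Fq
  have hsum := (sum_inv_add_span Fq hθ d (RatFunc.X ^ d) fun c => by
    rw [← algebraMap_monicOfDeg Fq]
    exact RatFunc.algebraMap_ne_zero (monicOfDeg_ne_zero Fq d c)).2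
  rw [carlitzE_theta_pow, prod_mul_inv_carlitzD Fq hθ] at hsum
  simp only [algebraMap_monicOfDeg, hsum, elld, map_prod, map_sub, map_pow, RatFunc.algebraMap_X]

end
end

section
/- For every integer d ≥ 0, Σ_{a∈A_{+,d}} a(t)/a = (t − θ)(t − θ^q)⋯(t − θ^{q^{d−1}})/ℓ_d in K[t] (with the empty product equal to 1 when d = 0). -/
open Polynomial

noncomputable section

variable (Fq : Type*) [Field Fq] [Fintype Fq]

/-- If the distinct nodes `v i` are all the roots of `F`, and its derivative is a nonzero
constant `β`, then `∑ g(v i) / v i = β g(0)` whenever `F(0) = -1` and `g` has degree less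
than the number of nodes. -/
theorem sum_inv_mul_eval_of_derivative_eq_C {L ι : Type*} [Field L] {s : Finset ι} {v : ι → L}
    (hv : Set.InjOn v s) {F g : L[X]} {β : L} (hβ : β ≠ 0) (hdeg : F.degree = s.card)
    (hroot : ∀ i ∈ s, F.eval (v i) = 0) (hder : derivative F = C β) (hzero : F.eval 0 = -1)
    (hg : g.degree < s.card) :
    ∑ i ∈ s, (v i)⁻¹ * g.eval (v i) = β * g.eval 0 := by
  classical
  have hF : F ≠ 0 := by rintro rfl; simp at hzero
  have hlead : F.leadingCoeff ≠ 0 := leadingCoeff_ne_zero.mpr hF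
  have hnodal : F = C F.leadingCoeff * Lagrange.nodal s v := by
    refine eq_of_degree_sub_lt_of_eval_index_eq s hv ?_ fun i hi => ?_
    · rw [← hdeg]
      refine degree_sub_lt_left ?_ hF ?_
      · rw [degree_C_mul hlead, Lagrange.degree_nodal, hdeg]
      · rw [leadingCoeff_mul, leadingCoeff_C, Lagrange.nodal_monic.leadingCoeff, mul_one]
    · rw [hroot i hi, eval_mul, Lagrange.eval_nodal_at_node hi, mul_zero]
  have hne : ∀ i ∈ s, (0 : L) ≠ v i := by
    intro i hi h
    have := hroot i hi
    rw [← h, hzero] at this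
    simp at this
  have hweight : ∀ i ∈ s, Lagrange.nodalWeight s v i = F.leadingCoeff / β := by
    intro i hi
    have h : F.leadingCoeff * eval (v i) (derivative (Lagrange.nodal s v)) = β := by
      have := congrArg (eval (v i)) hder
      rwa [hnodal, derivative_C_mul, eval_mul, eval_C, eval_C] at this
    rw [Lagrange.nodalWeight_eq_eval_derivative_nodal hi, ← h, div_mul_cancel_left₀ hlead]
  have hnodal_zero : F.leadingCoeff * eval 0 (Lagrange.nodal s v) = -1 := by
    rw [← hzero]
    conv_rhs => rw [hnodal, eval_mul, eval_C]
  have hinterp := congrArg (eval 0) (Lagrange.eq_interpolate hv hg)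
  rw [Lagrange.eval_interpolate_not_at_node _ hne] at hinterp
  have hsum : ∑ i ∈ s, Lagrange.nodalWeight s v i * (0 - v i)⁻¹ * eval (v i) g =
      -(F.leadingCoeff / β) * ∑ i ∈ s, (v i)⁻¹ * eval (v i) g := by
    rw [Finset.mul_sum]
    refine Finset.sum_congr rfl fun i hi => ?_
    rw [hweight i hi, zero_sub, inv_neg]
    ring
  rw [hinterp, hsum]
  field_simp
  linear_combination (∑ i ∈ s, eval (v i) g / v i) * hnodal_zero

section Additive

variable {L : Type*} [Field L]

/-- The additive polynomial `∑ j ≤ d, z ^ q ^ j / ∏ i ≠ j, (θ ^ q ^ j - θ ^ q ^ i)`, which takes the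
value `1` at every monic polynomial of degree `d` in `θ`. -/
def additiveLagrange (q : ℕ) (θ : L) (d : ℕ) : L[X] :=
  ∑ j ∈ Finset.range (d + 1),
    C (Lagrange.nodalWeight (Finset.range (d + 1)) (fun i => θ ^ q ^ i) j) * X ^ q ^ j

theorem degree_additiveLagrange {q : ℕ} (hq : 1 < q) {θ : L}
    (hθ : Function.Injective fun i : ℕ => θ ^ q ^ i) (d : ℕ) :
    (additiveLagrange q θ d).degree = (q ^ d : ℕ) := by
  rw [additiveLagrange, Finset.sum_range_succ, degree_add_eq_right_of_degree_lt]
  · exact degree_C_mul_X_pow _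
      (Lagrange.nodalWeight_ne_zero hθ.injOn (Finset.self_mem_range_succ d))
  · rw [degree_C_mul_X_pow _
      (Lagrange.nodalWeight_ne_zero hθ.injOn (Finset.self_mem_range_succ d))]
    refine (degree_sum_le _ _).trans_lt ?_
    rw [Finset.sup_lt_iff (WithBot.bot_lt_coe _)]
    intro j hj
    refine (degree_C_mul_X_pow_le _ _).trans_lt ?_
    exact_mod_cast Nat.pow_lt_pow_right hq (Finset.mem_range.mp hj)

theorem derivative_additiveLagrange {q : ℕ} (hq : (q : L) = 0) (θ : L) (d : ℕ) :
    derivative (additiveLagrange q θ d) =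
      C (Lagrange.nodalWeight (Finset.range (d + 1)) (fun i => θ ^ q ^ i) 0) := by
  rw [additiveLagrange, derivative_sum, Finset.sum_range_succ', Finset.sum_eq_zero, zero_add]
  · simp
  · intro j _
    simp [derivative_X_pow, hq]

theorem eval_zero_additiveLagrange {q : ℕ} (hq : q ≠ 0) (θ : L) (d : ℕ) :
    (additiveLagrange q θ d).eval 0 = 0 := by
  simp [additiveLagrange, eval_finsetSum, hq]

variable {Fq}
variable [Algebra Fq L]

theorem aeval_pow_card_pow (θ : L) (a : Fq[X]) (j : ℕ) :
    aeval (θ ^ Fintype.card Fq ^ j) a = aeval θ a ^ Fintype.card Fq ^ j := by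
  induction j with
  | zero => simp
  | succ j ih =>
    rw [pow_succ, pow_mul, pow_mul, ← ih]
    exact aeval_algHom_apply (FiniteField.frobeniusAlgHom Fq L) _ a

theorem eval_additiveLagrange_aeval {θ : L}
    (hθ : Function.Injective fun i : ℕ => θ ^ Fintype.card Fq ^ i) {a : Fq[X]} {d : ℕ}
    (ha : a.Monic) (hd : a.natDegree = d) :
    (additiveLagrange (Fintype.card Fq) θ d).eval (aeval θ a) = 1 := by
  have hdeg : (a.map (algebraMap Fq L)).degree = d := by
    rw [degree_map, degree_eq_natDegree ha.ne_zero, hd]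
  have h := Lagrange.leadingCoeff_eq_sum (s := Finset.range (d + 1)) hθ.injOn
    (P := a.map (algebraMap Fq L)) (by rw [hdeg]; simp)
  rw [(ha.map _).leadingCoeff] at h
  rw [h, additiveLagrange, eval_finsetSum]
  refine Finset.sum_congr rfl fun j _ => ?_
  rw [eval_mul, eval_C, eval_pow, eval_X, ← aeval_pow_card_pow, eval_map_algebraMap,
    Lagrange.nodalWeight, Finset.prod_inv_distrib, mul_comm, div_eq_mul_inv]

theorem Transcendental.pow_card_pow_injective {θ : L} (hθ : Transcendental Fq θ) :
    Function.Injective fun i : ℕ => θ ^ Fintype.card Fq ^ i := by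
  intro i j h
  have h' : (X ^ Fintype.card Fq ^ i : Fq[X]) = X ^ Fintype.card Fq ^ j :=
    transcendental_iff_injective.mp hθ (by simpa using h)
  have := congrArg natDegree h'
  rw [natDegree_X_pow, natDegree_X_pow] at this
  exact Nat.pow_right_injective Fintype.one_lt_card this

end Additive

theorem degree_sum_C_mul_X_pow_lt (k : Type*) [Field k] (d : ℕ) (c : Fin d → k) :
    (∑ i : Fin d, C (c i) * X ^ (i : ℕ)).degree < (d : WithBot ℕ) := by
  refine (degree_sum_le _ _).trans_lt ((Finset.sup_lt_iff (WithBot.bot_lt_coe d)).mpr fun i _ => ?_)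
  exact (degree_C_mul_X_pow_le _ _).trans_lt (Nat.cast_lt.mpr i.isLt)

theorem monicOfDeg_monic (k : Type*) [Field k] (d : ℕ) (c : Fin d → k) : (monicOfDeg k d c).Monic :=
  monic_X_pow_add (degree_sum_C_mul_X_pow_lt k d c)

theorem degree_monicOfDeg (k : Type*) [Field k] (d : ℕ) (c : Fin d → k) :
    (monicOfDeg k d c).degree = d := by
  rw [monicOfDeg, degree_add_eq_left_of_degree_lt, degree_X_pow]
  rw [degree_X_pow]
  exact degree_sum_C_mul_X_pow_lt k d c

theorem coeff_monicOfDeg (k : Type*) [Field k] (d : ℕ) (c : Fin d → k) (i : Fin d) :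
    (monicOfDeg k d c).coeff i = c i := by
  simp [monicOfDeg, coeff_X_pow, finsetSum_coeff, i.isLt.ne, Fin.val_inj]

theorem monicOfDeg_injective (k : Type*) [Field k] (d : ℕ) : Function.Injective (monicOfDeg k d) := by
  intro c c' h
  funext i
  rw [← coeff_monicOfDeg k d c i, h, coeff_monicOfDeg]

theorem nodalWeight_zero_eq_inv_aeval_elld {L : Type*} [Field L] [Algebra Fq L] (θ : L) (d : ℕ) :
    Lagrange.nodalWeight (Finset.range (d + 1)) (fun i => θ ^ Fintype.card Fq ^ i) 0 =
      (aeval θ (elld Fq d))⁻¹ := by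
  have : (Finset.range (d + 1)).erase 0 = Finset.Icc 1 d := by
    ext i
    simp
    lia
  simp [Lagrange.nodalWeight, elld, this, Finset.prod_inv_distrib, map_prod]

/-- Power sums over the monic polynomials of degree `d`: for `deg g < q ^ d`,
`∑ g(a) / a = g(0) / ℓ_d`. -/
theorem sum_inv_mul_eval_monicOfDeg {L : Type*} [Field L] [Algebra Fq L] {θ : L}
    (hθ : Transcendental Fq θ) (d : ℕ) {g : L[X]} (hg : g.degree < (Fintype.card Fq ^ d : ℕ)) :
    ∑ c : Fin d → Fq, (aeval θ (monicOfDeg Fq d c))⁻¹ * g.eval (aeval θ (monicOfDeg Fq d c)) =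
      (aeval θ (elld Fq d))⁻¹ * g.eval 0 := by
  have hinj := hθ.pow_card_pow_injective
  have hcard : (Finset.univ : Finset (Fin d → Fq)).card = Fintype.card Fq ^ d := by simp
  have hq : (Fintype.card Fq : L) = 0 := by
    rw [← map_natCast (algebraMap Fq L), Nat.cast_card_eq_zero, map_zero]
  have hdeg := degree_additiveLagrange Fintype.one_lt_card hinj d
  rw [← nodalWeight_zero_eq_inv_aeval_elld]
  refine sum_inv_mul_eval_of_derivative_eq_C
    (F := additiveLagrange (Fintype.card Fq) θ d - C 1) ?_ ?_ ?_ ?_ ?_ ?_ ?_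
  · exact ((transcendental_iff_injective.mp hθ).comp (monicOfDeg_injective Fq d)).injOn
  · exact Lagrange.nodalWeight_ne_zero hinj.injOn (by simp)
  · rw [degree_sub_C, hdeg, hcard]
    rw [hdeg]
    exact_mod_cast pow_pos Fintype.card_pos d
  · intro c _
    rw [eval_sub, eval_C, eval_additiveLagrange_aeval hinj (monicOfDeg_monic Fq d c)
      (natDegree_eq_of_degree_eq_some (degree_monicOfDeg Fq d c)), sub_self]
  · rw [derivative_sub, derivative_C, sub_zero, derivative_additiveLagrange hq]
  · rw [eval_sub, eval_C, eval_zero_additiveLagrange Fintype.card_ne_zero, zero_sub]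
  · rwa [hcard]

/-- For every `d ≥ 0`:
`Σ_{a ∈ A_{+,d}} a(t)/a = (t-θ)(t-θ^q)⋯(t-θ^{q^{d-1}})/ℓ_d` in `K[t]` (the empty product
being `1` for `d = 0`).  Here `a(t)` is `a` with `t` substituted for `θ`, viewed in
`K[t]` via the coefficient embedding `Fq ↪ K`. -/
theorem sum_monic_t_div_a (d : ℕ) :
    (∑ c : Fin d → Fq,
        Polynomial.C (algebraMap (Polynomial Fq) (RatFunc Fq) (monicOfDeg Fq d c))⁻¹ *
          (monicOfDeg Fq d c).map (algebraMap Fq (RatFunc Fq))) =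
      Polynomial.C (algebraMap (Polynomial Fq) (RatFunc Fq) (elld Fq d))⁻¹ *
        ∏ i ∈ Finset.range d,
          (Polynomial.X - Polynomial.C (algebraMap (Polynomial Fq) (RatFunc Fq)
            ((Polynomial.X : Polynomial Fq) ^ Fintype.card Fq ^ i))) := by
  have hθ : Transcendental Fq (RatFunc.X : RatFunc Fq) := RatFunc.transcendental_X
  have hinj := hθ.pow_card_pow_injective
  simp only [← RatFunc.aeval_X_left_eq_algebraMap, map_pow (aeval _), aeval_X]
  rw [← Lagrange.nodal_eq]
  have hsum_inv : ∑ c : Fin d → Fq, (aeval (RatFunc.X : RatFunc Fq) (monicOfDeg Fq d c))⁻¹ =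
      (aeval RatFunc.X (elld Fq d))⁻¹ := by
    simpa using sum_inv_mul_eval_monicOfDeg Fq hθ d (g := 1)
      (by rw [degree_one]; exact_mod_cast pow_pos Fintype.card_pos d)
  rw [← hsum_inv, map_sum, Finset.sum_mul]
  refine eq_of_degree_sub_lt_of_eval_index_eq (Finset.range d) hinj.injOn ?_ fun i hi => ?_
  · rw [← Finset.sum_sub_distrib]
    refine (degree_sum_le _ _).trans_lt
      ((Finset.sup_lt_iff (WithBot.bot_lt_coe _)).mpr fun c _ => ?_)
    rw [← mul_sub]
    have hmonic := (monicOfDeg_monic Fq d c).map (algebraMap Fq (RatFunc Fq))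
    have hdeg : ((monicOfDeg Fq d c).map (algebraMap Fq (RatFunc Fq))).degree = d := by
      rw [degree_map, degree_monicOfDeg]
    refine (degree_mul_le _ _).trans_lt ((add_le_of_nonpos_left degree_C_le).trans_lt ?_)
    refine (degree_sub_lt_left ?_ hmonic.ne_zero ?_).trans_eq ?_
    · rw [hdeg, Lagrange.degree_nodal, Finset.card_range]
    · rw [hmonic.leadingCoeff, Lagrange.nodal_monic.leadingCoeff]
    · rw [hdeg, Finset.card_range]
  · have hpow := sum_inv_mul_eval_monicOfDeg Fq hθ d (g := X ^ Fintype.card Fq ^ i) (by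
      rw [degree_X_pow]
      exact_mod_cast Nat.pow_lt_pow_right Fintype.one_lt_card (Finset.mem_range.mp hi))
    have hnodal := Lagrange.eval_nodal_at_node (v := fun i =>
      (RatFunc.X : RatFunc Fq) ^ Fintype.card Fq ^ i) hi
    simp only [eval_finsetSum, eval_mul, eval_C, hnodal, mul_zero, Finset.sum_const_zero,
      eval_map_algebraMap, aeval_pow_card_pow]
    simpa using hpow

end
end

section
/- Assume q = p is prime. Let d, N ≥ 1 and k = (k_0,…,k_{d−1}) ∈ {0,…,p−1}^d with |k| ≤ ℓ_p(N). Write N = Σ_{l=1}^{ℓ_p(N)} p^{e_l} with e_1 ≤ e_2 ≤ ⋯ ≤ e_{ℓ_p(N)}, set σ_0 = 0, σ_i = k_0 + ⋯ + k_{i−1} for 1 ≤ i ≤ d, σ_{d+1} = ℓ_p(N), and define m = (m_0,…,m_d) by m_n = Σ_{l=σ_n+1}^{σ_{n+1}} p^{e_l} for n = 0,…,d. Then m ∈ U_d(N,k) and m is the greedy element of U_d(N,k). Consequently, for k ∈ {0,…,p−1}^d, U_d(N,k) ≠ ∅ if and only if |k| ≤ ℓ_p(N). -/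
noncomputable section

/-- `U_d(N,k)`: tuples `m = (m_0,…,m_d) ∈ ℕ^{d+1}` with `m_0 + ⋯ + m_d = N`, no carryover
of `p`-digits in this sum (i.e. `ℓ_p(N) = Σ_n ℓ_p(m_n)`), and `m_n - k_n ∈ (p-1)ℕ` for
`n = 0,…,d-1`. -/
def Ud (p d N : ℕ) (k : Fin d → ℕ) : Set (Fin (d + 1) → ℕ) :=
  {m | (∑ n : Fin (d + 1), m n) = N ∧
    (Nat.digits p N).sum = ∑ n : Fin (d + 1), (Nat.digits p (m n)).sum ∧
    ∀ n : Fin d, ∃ c : ℕ, m n.castSucc = k n + (p - 1) * c}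

/-- `deg m = m_1 + 2m_2 + ⋯ + d·m_d`. -/
def degU {d : ℕ} (m : Fin (d + 1) → ℕ) : ℕ :=
  ∑ n : Fin (d + 1), (n : ℕ) * m n

/-- `m' ≤ m` for the lexicographic order on the reversed tuples `(m_d, m_{d-1}, …)`. -/
def RevLexLe {d : ℕ} (m' m : Fin (d + 1) → ℕ) : Prop :=
  m' = m ∨ ∃ i : Fin (d + 1),
    (∀ j : Fin (d + 1), j < i → m' (Fin.rev j) = m (Fin.rev j)) ∧
      m' (Fin.rev i) < m (Fin.rev i)

/-- `m` is the greedy element of `U_d(N,k)`: it belongs to `U_d(N,k)` and its reversed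
tuple is lexicographically largest. -/
def IsGreedyU (p d N : ℕ) (k : Fin d → ℕ) (m : Fin (d + 1) → ℕ) : Prop :=
  m ∈ Ud p d N k ∧ ∀ m' ∈ Ud p d N k, RevLexLe m' m

end

section DigitSum

variable {p : ℕ} [Fact p.Prime]

/-- Every natural number is its `p`-digit sum plus a multiple of `p - 1`. -/
theorem eq_digits_sum_add_sub_one_mul (n : ℕ) :
    n = (p.digits n).sum + (p - 1) * padicValNat p n.factorial := by
  have h₁ := sub_one_mul_padicValNat_factorial (p := p) n
  have h₂ := Nat.digit_sum_le p n
  omega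

theorem digits_sum_add_le (a b : ℕ) :
    (p.digits (a + b)).sum ≤ (p.digits a).sum + (p.digits b).sum := by
  have hval : padicValNat p a.factorial + padicValNat p b.factorial ≤
      padicValNat p (a + b).factorial := by
    rw [← padicValNat.mul a.factorial_ne_zero b.factorial_ne_zero,
      ← padicValNat_dvd_iff_le (a + b).factorial_ne_zero]
    exact pow_padicValNat_dvd.trans (Nat.factorial_mul_factorial_dvd_factorial_add a b)
  have ha := eq_digits_sum_add_sub_one_mul (p := p) a
  have hb := eq_digits_sum_add_sub_one_mul (p := p) b
  have hab := eq_digits_sum_add_sub_one_mul (p := p) (a + b)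
  have hmul := Nat.mul_le_mul_left (p - 1) hval
  rw [mul_add] at hmul
  omega

theorem digits_sum_sum_le {ι : Type*} (s : Finset ι) (f : ι → ℕ) :
    (p.digits (∑ i ∈ s, f i)).sum ≤ ∑ i ∈ s, (p.digits (f i)).sum :=
  Finset.le_sum_of_subadditive (fun n => (p.digits n).sum) (by simp) digits_sum_add_le s f

theorem digits_sum_pow (x : ℕ) : (p.digits (p ^ x)).sum = 1 := by
  have hp : 1 < p := (Fact.out : p.Prime).one_lt
  have h := Nat.digits_base_pow_mul (k := x) hp one_pos
  rw [mul_one, Nat.digits_of_lt p 1 one_ne_zero hp] at h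
  simp [h]

theorem le_digits_sum_of_eq_add_sub_one_mul {m k c : ℕ} (hk : k ≤ p - 1)
    (hm : m = k + (p - 1) * c) : k ≤ (p.digits m).sum := by
  have hdecomp := eq_digits_sum_add_sub_one_mul (p := p) m
  set s := (p.digits m).sum
  set v := padicValNat p m.factorial
  by_contra! hlt
  have hpos : 0 < s := by
    by_contra! h
    have h0 : m = 0 := by
      by_contra hne
      have := Nat.getLast_digit_ne_zero p hne
      have hmem := List.getLast_mem ((Nat.digits_ne_nil_iff_ne_zero (b := p)).mpr hne)
      exact this (List.sum_eq_zero_iff.mp (Nat.le_zero.mp h) _ hmem)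
    omega
  have hcv : c < v := by
    by_contra! h
    have := Nat.mul_le_mul_left (p - 1) h
    omega
  have := Nat.mul_le_mul_left (p - 1) (Nat.succ_le_of_lt hcv)
  rw [Nat.succ_eq_add_one, mul_add] at this
  omega

end DigitSum

/-- The sum of `p ^ x` over the elements `x` of a multiset of exponents. -/
def powSum (p : ℕ) : Multiset ℕ →+ ℕ :=
  Multiset.sumAddMonoidHom.comp (Multiset.mapAddMonoidHom (p ^ ·))

theorem powSum_apply (p : ℕ) (M : Multiset ℕ) : powSum p M = (M.map (p ^ ·)).sum := rfl

theorem powSum_eq_sum_range {p : ℕ} {M : Multiset ℕ} {K : ℕ} (hM : ∀ x ∈ M, x < K) :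
    powSum p M = ∑ i : Fin K, M.count (i : ℕ) * p ^ (i : ℕ) := by
  rw [Fin.sum_univ_eq_sum_range (fun i => M.count i * p ^ i), powSum_apply,
    Finset.sum_multiset_map_count]
  refine Finset.sum_subset (fun x hx => Finset.mem_range.mpr (hM x (Multiset.mem_toFinset.mp hx)))
    fun x _ hx => ?_
  rw [Multiset.count_eq_zero_of_notMem (mt Multiset.mem_toFinset.mpr hx), zero_smul]

theorem eq_of_powSum_eq_of_count_lt {p : ℕ} {M M' : Multiset ℕ} (hM : ∀ x, M.count x < p)
    (hM' : ∀ x, M'.count x < p) (h : powSum p M = powSum p M') : M = M' := by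
  obtain ⟨K, hK⟩ : ∃ K, ∀ x ∈ M + M', x < K :=
    ⟨(M + M').sup + 1, fun x hx => Nat.lt_succ_of_le (Multiset.le_sup hx)⟩
  have hKM : ∀ x ∈ M, x < K := fun x hx => hK x (Multiset.mem_add.mpr (Or.inl hx))
  have hKM' : ∀ x ∈ M', x < K := fun x hx => hK x (Multiset.mem_add.mpr (Or.inr hx))
  rw [powSum_eq_sum_range hKM, powSum_eq_sum_range hKM'] at h
  have hfun : (fun i : Fin K => (⟨M.count (i : ℕ), hM i⟩ : Fin p)) =
      fun i : Fin K => ⟨M'.count (i : ℕ), hM' i⟩ := by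
    apply finFunctionFinEquiv.injective
    apply Fin.ext
    simpa [finFunctionFinEquiv_apply_val] using h
  ext x
  by_cases hx : x < K
  · simpa using congrFun hfun ⟨x, hx⟩
  · rw [Multiset.count_eq_zero_of_notMem (fun hm => hx (hKM x hm)),
      Multiset.count_eq_zero_of_notMem (fun hm => hx (hKM' x hm))]

section PowSum

variable {p : ℕ} [Fact p.Prime]

theorem digits_sum_powSum_le_card (M : Multiset ℕ) : (p.digits (powSum p M)).sum ≤ M.card := by
  induction M using Multiset.induction with
  | empty => simp
  | cons x M ih =>
    have h := digits_sum_add_le (p := p) (p ^ x) (powSum p M)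
    rw [digits_sum_pow] at h
    rw [powSum_apply, Multiset.map_cons, Multiset.sum_cons, Multiset.card_cons, ← powSum_apply]
    omega

theorem exists_powSum_eq_card_eq (n : ℕ) :
    ∃ M : Multiset ℕ, powSum p M = n ∧ M.card = (p.digits n).sum := by
  have hp : 1 < p := (Fact.out : p.Prime).one_lt
  induction n using Nat.strong_induction_on with
  | _ n ih =>
    rcases Nat.eq_zero_or_pos n with rfl | hn
    · exact ⟨0, by simp⟩
    · obtain ⟨M, hM, hcard⟩ := ih (n / p) (Nat.div_lt_self hn hp)
      refine ⟨Multiset.replicate (n % p) 0 + M.map Nat.succ, ?_, ?_⟩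
      · have hshift : powSum p (M.map Nat.succ) = powSum p M * p := by
          simp [powSum_apply, Multiset.map_map, pow_succ, Multiset.sum_map_mul_right]
        rw [map_add, hshift, hM, powSum_apply]
        simpa [mul_comm] using Nat.mod_add_div n p
      · simp [Nat.digits_def' hp hn, hcard]

/-- In a representation of a number by the minimal number of powers of `p`, each power occurs
less than `p` times. -/
theorem count_lt_of_card_eq_digits_sum {M : Multiset ℕ}
    (h : M.card = (p.digits (powSum p M)).sum) (x : ℕ) : M.count x < p := by
  have hp : 1 < p := (Fact.out : p.Prime).one_lt
  by_contra! hx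
  obtain ⟨R, rfl⟩ := Multiset.le_iff_exists_add.mp (Multiset.le_count_iff_replicate_le.mp hx)
  have hcarry : powSum p (Multiset.replicate p x + R) = powSum p ((x + 1) ::ₘ R) := by
    simp [powSum_apply, pow_succ, mul_comm]
  have hle := digits_sum_powSum_le_card (p := p) ((x + 1) ::ₘ R)
  rw [← hcarry, ← h] at hle
  simp at hle
  omega

/-- A number has only one representation by the minimal number of powers of `p`. -/
theorem eq_of_powSum_eq_of_card_eq_digits_sum {M M' : Multiset ℕ}
    (hM : M.card = (p.digits (powSum p M)).sum) (hM' : M'.card = (p.digits (powSum p M')).sum)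
    (h : powSum p M = powSum p M') : M = M' :=
  eq_of_powSum_eq_of_count_lt (count_lt_of_card_eq_digits_sum hM)
    (count_lt_of_card_eq_digits_sum hM') h

/-- Among the submultisets of `B + T` with at most `T.card` elements, where the elements of `B`
are bounded by those of `T`, the multiset `T` has the largest sum of powers. -/
theorem powSum_le_of_le_add {M B T : Multiset ℕ} (hle : M ≤ B + T) (hcard : M.card ≤ T.card)
    (hBT : ∀ x ∈ B, ∀ y ∈ T, x ≤ y) : powSum p M ≤ powSum p T := by
  have hp : 0 < p := (Fact.out : p.Prime).pos
  rcases eq_or_ne T 0 with rfl | hT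
  · have : M = 0 := by simpa using hcard
    simp [this]
  obtain ⟨y, hy, hmin⟩ := Multiset.exists_min_image id hT
  have hB : (B.map fun x => p ^ x - p ^ y).sum = 0 := by
    refine Multiset.sum_eq_zero fun z hz => ?_
    obtain ⟨x, hx, rfl⟩ := Multiset.mem_map.mp hz
    exact Nat.sub_eq_zero_of_le (Nat.pow_le_pow_right hp (hBT x hx y hy))
  have hsub : (M.map fun x => p ^ x - p ^ y).sum ≤ (T.map fun x => p ^ x - p ^ y).sum := by
    obtain ⟨R, hR⟩ := Multiset.le_iff_exists_add.mp hle
    have := congrArg (fun S : Multiset ℕ => (S.map fun x => p ^ x - p ^ y).sum) hR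
    simp only [Multiset.map_add, Multiset.sum_add, hB] at this
    omega
  calc powSum p M
      ≤ (M.map fun x => (p ^ x - p ^ y) + p ^ y).sum :=
        Multiset.sum_map_le_sum_map _ _ fun x _ => by omega
    _ = (M.map fun x => p ^ x - p ^ y).sum + M.card * p ^ y := by simp [Multiset.sum_map_add]
    _ ≤ (T.map fun x => p ^ x - p ^ y).sum + T.card * p ^ y := by gcongr
    _ = (T.map fun x => (p ^ x - p ^ y) + p ^ y).sum := by simp [Multiset.sum_map_add]
    _ = powSum p T := by
        rw [powSum_apply]
        refine congrArg Multiset.sum (Multiset.map_congr rfl fun x hx => ?_)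
        exact Nat.sub_add_cancel (Nat.pow_le_pow_right hp (hmin x hx))

end PowSum

section Blocks

variable {p : ℕ} [Fact p.Prime] {ι : Type*} [Fintype ι]

/-- If the blocks `E i` jointly form a minimal representation, each of them is minimal. -/
theorem card_eq_digits_sum_of_sum_card {E : ι → Multiset ℕ}
    (hE : ∑ i, (E i).card = (p.digits (∑ i, powSum p (E i))).sum) (i : ι) :
    (E i).card = (p.digits (powSum p (E i))).sum := by
  have hle : ∀ i ∈ Finset.univ, (p.digits (powSum p (E i))).sum ≤ (E i).card :=
    fun i _ => digits_sum_powSum_le_card (E i)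
  have hsum : ∑ i, (p.digits (powSum p (E i))).sum = ∑ i, (E i).card :=
    le_antisymm (Finset.sum_le_sum hle) (hE ▸ digits_sum_sum_le _ _)
  exact ((Finset.sum_eq_sum_iff_of_le hle).mp hsum i (Finset.mem_univ i)).symm

theorem le_powSum_block [LinearOrder ι] {E : ι → Multiset ℕ} {m : ι → ℕ} {n : ι}
    (hE : ∑ i, (E i).card = (p.digits (∑ i, powSum p (E i))).sum)
    (hsum : ∑ i, m i = ∑ i, powSum p (E i))
    (hdig : ∑ i, (p.digits (m i)).sum = (p.digits (∑ i, powSum p (E i))).sum)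
    (hlow : ∀ i < n, (E i).card ≤ (p.digits (m i)).sum)
    (hhigh : ∀ i, n < i → m i = powSum p (E i))
    (hsorted : ∀ i < n, ∀ x ∈ E i, ∀ y ∈ E n, x ≤ y) :
    m n ≤ powSum p (E n) := by
  choose M hMpow hMcard using fun i => exists_powSum_eq_card_eq (p := p) (m i)
  have hME : ∑ i, M i = ∑ i, E i := by
    apply eq_of_powSum_eq_of_card_eq_digits_sum (p := p)
    · simp [map_sum, Multiset.card_sum, hMpow, hMcard, hdig, hsum]
    · simp [map_sum, Multiset.card_sum, hE]
    · simp [map_sum, hMpow, hsum]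
  have hblock : ∀ i, n < i → M i = E i := fun i hi =>
    eq_of_powSum_eq_of_card_eq_digits_sum (by rw [hMpow, hMcard])
      (card_eq_digits_sum_of_sum_card hE i) (by rw [hMpow, hhigh i hi])
  have hsplit : ∀ F : ι → Multiset ℕ, ∑ i, F i =
      (∑ i with i < n, F i) + F n + ∑ i with n < i, F i := fun F => by
    have h₁ : (Finset.univ.filter fun i => ¬ i < n) =
        insert n (Finset.univ.filter fun i => n < i) := by
      ext i
      simp [le_iff_eq_or_lt, eq_comm]
    rw [← Finset.sum_filter_add_sum_filter_not Finset.univ (fun i => i < n) F, h₁,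
      Finset.sum_insert (by simp), add_assoc]
  have hlowEq : (∑ i with i < n, M i) + M n = (∑ i with i < n, E i) + E n := by
    have hhighEq : ∑ i with n < i, M i = ∑ i with n < i, E i :=
      Finset.sum_congr rfl fun i hi => hblock i (Finset.mem_filter.mp hi).2
    rw [hsplit M, hsplit E, hhighEq] at hME
    exact add_right_cancel hME
  rw [← hMpow n]
  refine powSum_le_of_le_add (B := ∑ i with i < n, E i) (hlowEq ▸ Multiset.le_add_left _ _) ?_ ?_
  · have hcard := congrArg Multiset.card hlowEq
    simp only [Multiset.card_add, Multiset.card_sum] at hcard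
    have : ∑ i with i < n, (E i).card ≤ ∑ i with i < n, (M i).card :=
      Finset.sum_le_sum fun i hi => (hlow i (Finset.mem_filter.mp hi).2).trans_eq (hMcard i).symm
    omega
  · intro x hx
    obtain ⟨i, hi, hxi⟩ := Multiset.mem_sum.mp hx
    exact hsorted i (Finset.mem_filter.mp hi).2 x hxi

end Blocks

theorem revLexLe_of_forall_le {d : ℕ} {m' m : Fin (d + 1) → ℕ}
    (h : ∀ n, (∀ j, n < j → m' j = m j) → m' n ≤ m n) : RevLexLe m' m := by
  by_cases heq : m' = m
  · exact Or.inl heq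
  obtain ⟨n₀, hn₀⟩ := Function.ne_iff.mp heq
  obtain ⟨n, hn, hmax⟩ := (Finset.univ.filter fun n => m' n ≠ m n).exists_max_image id
    ⟨n₀, by simpa using hn₀⟩
  have hagree : ∀ j, n < j → m' j = m j := fun j hj => by
    by_contra hne
    exact absurd (hmax j (by simpa using hne)) (not_le.mpr hj)
  refine Or.inr ⟨n.rev, fun j hj => hagree _ (Fin.lt_rev_iff.mpr hj), ?_⟩
  rw [Fin.rev_rev]
  exact lt_of_le_of_ne (h n hagree) (Finset.mem_filter.mp hn).2

theorem sum_le_digits_sum_of_mem_Ud {p d N : ℕ} [Fact p.Prime] {k : Fin d → ℕ}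
    (hk : ∀ n, k n ≤ p - 1) {m : Fin (d + 1) → ℕ} (hm : m ∈ Ud p d N k) :
    ∑ n, k n ≤ (p.digits N).sum := by
  obtain ⟨-, hdig, hmod⟩ := hm
  rw [hdig, Fin.sum_univ_castSucc]
  refine le_add_right (Finset.sum_le_sum fun n _ => ?_)
  obtain ⟨c, hc⟩ := hmod n
  exact le_digits_sum_of_eq_add_sub_one_mul (hk n) hc

section Partition

variable {L : ℕ} {σ : ℕ → ℕ}

/-- The positions `l` with `σ n ≤ l < σ (n + 1)`. -/
def blockIndices (L : ℕ) (σ : ℕ → ℕ) (n : ℕ) : Finset (Fin L) :=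
  Finset.univ.filter fun l : Fin L => σ n ≤ (l : ℕ) ∧ (l : ℕ) < σ (n + 1)

theorem mem_blockIndices {n : ℕ} {l : Fin L} :
    l ∈ blockIndices L σ n ↔ σ n ≤ (l : ℕ) ∧ (l : ℕ) < σ (n + 1) := by
  simp [blockIndices]

theorem card_blockIndices {n : ℕ} (hn : σ (n + 1) ≤ L) :
    (blockIndices L σ n).card = σ (n + 1) - σ n := by
  rw [← Finset.card_map Fin.valEmbedding, ← Nat.card_Ico]
  congr 1
  ext l
  simp only [Finset.mem_map, mem_blockIndices, Finset.mem_Ico, Fin.valEmbedding_apply]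
  constructor
  · rintro ⟨x, hx, rfl⟩
    exact hx
  · exact fun hl => ⟨⟨l, hl.2.trans_le hn⟩, hl, rfl⟩

theorem sum_range_sum_blockIndices (hzero : σ 0 = 0) (hmono : Monotone σ) (f : Fin L → ℕ)
    (D : ℕ) : ∑ n ∈ Finset.range D, ∑ l ∈ blockIndices L σ n, f l =
      ∑ l ∈ Finset.univ.filter (fun l : Fin L => (l : ℕ) < σ D), f l := by
  induction D with
  | zero => simp [hzero]
  | succ D ih =>
    have hD := hmono D.le_succ
    rw [Finset.sum_range_succ, ih, blockIndices, Finset.sum_filter, Finset.sum_filter,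
      Finset.sum_filter, ← Finset.sum_add_distrib]
    refine Finset.sum_congr rfl fun l _ => ?_
    simp only [Nat.succ_eq_add_one] at hD
    split_ifs <;> omega

theorem sum_sum_blockIndices {d : ℕ} (hzero : σ 0 = 0) (hmono : Monotone σ)
    (hlast : σ (d + 1) = L) (f : Fin L → ℕ) :
    ∑ n : Fin (d + 1), ∑ l ∈ blockIndices L σ n, f l = ∑ l, f l := by
  rw [Fin.sum_univ_eq_sum_range (fun n => ∑ l ∈ blockIndices L σ n, f l),
    sum_range_sum_blockIndices hzero hmono, hlast]
  simp

end Partition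

theorem isGreedyU_of_blockIndices {p d N L : ℕ} [Fact p.Prime] (hL : L = (p.digits N).sum)
    {k : Fin d → ℕ} (hk : ∀ n, k n ≤ p - 1) {e : Fin L → ℕ} (he : Monotone e)
    (hNe : N = ∑ l, p ^ e l) {σ : ℕ → ℕ} (hzero : σ 0 = 0) (hmono : Monotone σ)
    (hstep : ∀ n : Fin d, σ (n + 1) = σ n + k n) (hlast : σ (d + 1) = L) :
    IsGreedyU p d N k fun n => ∑ l ∈ blockIndices L σ n, p ^ e l := by
  let E : Fin (d + 1) → Multiset ℕ := fun n => (blockIndices L σ n).val.map e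
  have hpow : ∀ n, powSum p (E n) = ∑ l ∈ blockIndices L σ n, p ^ e l := fun n => by
    simp [E, powSum_apply, Multiset.map_map]
  have hpowSum : ∑ n, powSum p (E n) = N := by
    simp only [hpow]
    rw [sum_sum_blockIndices hzero hmono hlast, ← hNe]
  have hcard : ∀ n : Fin d, (E n.castSucc).card = k n := fun n => by
    have hle : σ (n + 1) ≤ L := hlast ▸ hmono (by omega)
    have := card_blockIndices hle
    have := hstep n
    simp only [E, Multiset.card_map, Finset.card_val, Fin.val_castSucc]
    omega
  have hE : ∑ n, (E n).card = (p.digits (∑ n, powSum p (E n))).sum := by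
    have := sum_sum_blockIndices hzero hmono hlast fun _ : Fin L => 1
    simpa [E, hpowSum, ← hL] using this
  have hdig := card_eq_digits_sum_of_sum_card hE
  simp only [← hpow]
  refine ⟨⟨hpowSum, ?_, fun n => ?_⟩, fun m' hm' => revLexLe_of_forall_le fun n hn => ?_⟩
  · rw [← Finset.sum_congr rfl fun n _ => hdig n, hE, hpowSum]
  · rw [← hcard n, hdig]
    exact ⟨_, eq_digits_sum_add_sub_one_mul _⟩
  · obtain ⟨hsum, hdig', hmod⟩ := hm'
    refine le_powSum_block hE (hsum.trans hpowSum.symm) (by rw [hpowSum, hdig']) ?_ hn ?_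
    · intro i hi
      obtain ⟨j, rfl⟩ := Fin.exists_castSucc_eq.mpr (hi.trans_le n.le_last).ne
      obtain ⟨c, hc⟩ := hmod j
      rw [hcard]
      exact le_digits_sum_of_eq_add_sub_one_mul (hk j) hc
    · intro i hi x hx y hy
      obtain ⟨l, hl, rfl⟩ := Multiset.mem_map.mp hx
      obtain ⟨l', hl', rfl⟩ := Multiset.mem_map.mp hy
      have h₁ := (mem_blockIndices.mp hl).2
      have h₂ := (mem_blockIndices.mp hl').1
      have h₃ : σ (i + 1) ≤ σ n := hmono hi
      exact he (Fin.le_def.mpr (by omega))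

/-- The partial sums `σ_i = k_0 + ⋯ + k_{i-1}` for `i ≤ d`, continued by the constant `L`. -/
def partialSums {d : ℕ} (k : Fin d → ℕ) (L i : ℕ) : ℕ :=
  if i ≤ d then ∑ n ∈ Finset.range i, (if h : n < d then k ⟨n, h⟩ else 0) else L

section PartialSums

variable {d : ℕ} (k : Fin d → ℕ) (L : ℕ)

theorem partialSums_zero : partialSums k L 0 = 0 := by simp [partialSums]

theorem partialSums_succ (n : Fin d) :
    partialSums k L (n + 1) = partialSums k L n + k n := by
  have h₁ : (n : ℕ) + 1 ≤ d := n.isLt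
  simp [partialSums, h₁, n.isLt.le, Finset.sum_range_succ]

theorem partialSums_last : partialSums k L (d + 1) = L := by simp [partialSums]

theorem partialSums_self : partialSums k L d = ∑ n, k n := by
  simp [partialSums, Finset.sum_range]

variable {k L} in
theorem monotone_partialSums (hkL : ∑ n, k n ≤ L) : Monotone (partialSums k L) := by
  refine monotone_nat_of_le_succ fun n => ?_
  rcases lt_trichotomy n d with hn | rfl | hn
  · exact (Nat.le_add_right _ _).trans_eq (partialSums_succ k L ⟨n, hn⟩).symm
  · rwa [partialSums_last, partialSums_self]
  · simp [partialSums, hn.not_ge, (hn.trans n.lt_succ_self).not_ge]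

end PartialSums

theorem isGreedyU_partialSums {p d N : ℕ} [Fact p.Prime] {k : Fin d → ℕ}
    (hk : ∀ n, k n ≤ p - 1) (hkl : ∑ n, k n ≤ (p.digits N).sum)
    {e : Fin (p.digits N).sum → ℕ} (he : Monotone e) (hNe : N = ∑ l, p ^ e l) :
    IsGreedyU p d N k fun n =>
      ∑ l ∈ blockIndices (p.digits N).sum (partialSums k (p.digits N).sum) n, p ^ e l :=
  isGreedyU_of_blockIndices rfl hk he hNe (partialSums_zero k _) (monotone_partialSums hkl)
    (partialSums_succ k _) (partialSums_last k _)

noncomputable section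

/-- Let `q = p` be prime, `d, N ≥ 1`, `k ∈ {0,…,p-1}^d` with `|k| ≤ ℓ_p(N)`.  Write
`N = Σ_{l} p^{e_l}` with `e` (indexed by `Fin ℓ_p(N)`) nondecreasing; set `σ_0 = 0`,
`σ_i = k_0 + ⋯ + k_{i-1}` for `1 ≤ i ≤ d`, `σ_{d+1} = ℓ_p(N)`, and
`m_n = Σ_{σ_n ≤ l < σ_{n+1}} p^{e_l}`.  Then `m ∈ U_d(N,k)` and `m` is the greedy element
of `U_d(N,k)`.  Consequently, for every `k' ∈ {0,…,p-1}^d`, `U_d(N,k') ≠ ∅` if and only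
if `|k'| ≤ ℓ_p(N)`. -/
theorem greedy_element_of_Ud (p : ℕ) [Fact p.Prime] (d N : ℕ) (hd : 1 ≤ d) (hN : 1 ≤ N)
    (k : Fin d → ℕ) (hk : ∀ n, k n ≤ p - 1)
    (hkl : (∑ n, k n) ≤ (Nat.digits p N).sum)
    (e : Fin ((Nat.digits p N).sum) → ℕ) (he : Monotone e)
    (hNe : N = ∑ l, p ^ e l) :
    (let σ : ℕ → ℕ := fun i =>
        if i ≤ d then ∑ n ∈ Finset.range i, (if h : n < d then k ⟨n, h⟩ else 0)
        else (Nat.digits p N).sum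
      let m : Fin (d + 1) → ℕ := fun n =>
        ∑ l ∈ Finset.univ.filter
            (fun l : Fin ((Nat.digits p N).sum) => σ (n : ℕ) ≤ (l : ℕ) ∧ (l : ℕ) < σ ((n : ℕ) + 1)),
          p ^ e l
      m ∈ Ud p d N k ∧ IsGreedyU p d N k m) ∧
    (∀ k' : Fin d → ℕ, (∀ n, k' n ≤ p - 1) →
      ((Ud p d N k').Nonempty ↔ (∑ n, k' n) ≤ (Nat.digits p N).sum)) := by
  have hgreedy := isGreedyU_partialSums hk hkl he hNe
  refine ⟨⟨hgreedy.1, hgreedy⟩, fun k' hk' => ⟨?_, fun hkl' => ?_⟩⟩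
  · rintro ⟨m, hm⟩
    exact sum_le_digits_sum_of_mem_Ud hk' hm
  · exact ⟨_, (isGreedyU_partialSums hk' hkl' he hNe).1⟩

end
end
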